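/- Let ρ = (G_i)_{0 ≤ i ≤ n} be a 1-balanced execution of the reconfigurable broadcast network defined by a broadcast protocol P, and let κ = κ(ρ) be its total number of repeated atomic reconfigurations. Then for every N ≥ κ² + κ there exists a 1-constrained execution from G_0^N to G_n^N. -/

import Mathlib

/-!
Reconfigurable broadcast networks (Maubert–Pinchinat–Schlehuber-Caissier style
formalization of "Reconfiguration and message losses in parameterized broadcast networks").

A broadcast protocol is a tuple (Q, I, Σ, Δ); configurations are finite
Q-labelled simple graphs; steps are reconfiguration steps (labels unchanged,
edges arbitrary) or communication steps (edges unchanged, one node broadcasts,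
its neighbours receive); executions strictly alternate the two kinds of steps.
-/

namespace RBN

/-- An action of a broadcast protocol: broadcast `!!m` or reception `??m`. -/
inductive BAct (M : Type) where
  | brd : M → BAct M
  | rcv : M → BAct M

/-- A broadcast protocol `(Q, I, Σ, Δ)` with state space `Q` and message alphabet `M`:
initial states `init ⊆ Q` and transition relation `trans ⊆ Q × BAct M × Q`. -/
structure BroadcastProtocol (Q M : Type) where
  init : Set Q
  trans : Q → BAct M → Q → Prop

/-- A configuration: an undirected graph without self-loops on node set `V`,
whose nodes are labelled by states in `Q`. -/
structure Config (V Q : Type) where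
  graph : SimpleGraph V
  label : V → Q

/-- The distance `d(G, G')` between two configurations on the same node set with
the same labelling: the number of edges in the symmetric difference of the edge sets. -/
noncomputable def dist {V Q : Type} (G G' : Config V Q) : ℕ :=
  (symmDiff G.graph.edgeSet G'.graph.edgeSet).ncard

/-- The number of edges incident to node `v` in the symmetric difference of
the edge sets of `G` and `G'`. -/
noncomputable def localDist {V Q : Type} (v : V) (G G' : Config V Q) : ℕ :=
  {e ∈ symmDiff G.graph.edgeSet G'.graph.edgeSet | v ∈ e}.ncard

/-- A reconfiguration step: labels are unchanged and edges may change arbitrarily. -/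
def ReconfStep {V Q : Type} (G G' : Config V Q) : Prop :=
  G'.label = G.label

/-- A communication step: edges are unchanged, some node `v` broadcasts a message `m`
(performing a transition `(L v, !!m, L' v) ∈ Δ`), every neighbour `u` of `v` receives it
(performing `(L u, ??m, L' u) ∈ Δ`), and every other node keeps its label. -/
def CommStep {V Q M : Type} (P : BroadcastProtocol Q M) (G G' : Config V Q) : Prop :=
  G'.graph = G.graph ∧
  ∃ (v : V) (m : M),
    P.trans (G.label v) (.brd m) (G'.label v) ∧
    (∀ u, G.graph.Adj v u → P.trans (G.label u) (.rcv m) (G'.label u)) ∧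
    (∀ u, u ≠ v → ¬ G.graph.Adj v u → G'.label u = G.label u)

/-- The type of a step: communication or reconfiguration. -/
inductive StepType where
  | comm : StepType
  | reconf : StepType
deriving DecidableEq

/-- An execution of length `r` of the reconfigurable broadcast network defined by `P`,
with node set `V`: a sequence of configurations `cfg 0, …, cfg r` together with a
classification `ty` of each step, such that each step is of its declared kind and
communication and reconfiguration steps strictly alternate (reconfiguration steps
may be trivial). -/
structure Execution {Q M : Type} (V : Type) (P : BroadcastProtocol Q M) (r : ℕ) where
  cfg : ℕ → Config V Q
  ty : ℕ → StepType
  step_comm : ∀ i < r, ty i = .comm → CommStep P (cfg i) (cfg (i + 1))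
  step_reconf : ∀ i < r, ty i = .reconf → ReconfStep (cfg i) (cfg (i + 1))
  alternate : ∀ i, i + 1 < r → ty (i + 1) ≠ ty i

variable {Q M V : Type} {P : BroadcastProtocol Q M} {r : ℕ}

/-- An execution is initial if every node of its first configuration is labelled
by an initial state. -/
def Execution.Initial (ρ : Execution V P r) : Prop :=
  ∀ v, (ρ.cfg 0).label v ∈ P.init

/-- An execution synchronizes in `F` if every node of its last configuration is
labelled by a state in `F`. -/
def Execution.Synchronizes (ρ : Execution V P r) (F : Set Q) : Prop :=
  ∀ v, (ρ.cfg r).label v ∈ F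

/-- An execution is `k`-constrained if every reconfiguration step changes at most
`k` edges. -/
def Execution.KConstrained (k : ℕ) (ρ : Execution V P r) : Prop :=
  ∀ i < r, ρ.ty i = .reconf → dist (ρ.cfg i) (ρ.cfg (i + 1)) ≤ k

/-- An execution is strongly `k`-constrained if every reconfiguration step changes
exactly `k` edges. -/
def Execution.StronglyKConstrained (k : ℕ) (ρ : Execution V P r) : Prop :=
  ∀ i < r, ρ.ty i = .reconf → dist (ρ.cfg i) (ρ.cfg (i + 1)) = k

/-- An execution is `k`-locally-constrained if, at every step and for every node `v`,
at most `k` edges incident to `v` belong to the symmetric difference of the edge sets. -/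
def Execution.LocallyConstrained (k : ℕ) (ρ : Execution V P r) : Prop :=
  ∀ (v : V), ∀ i < r, localDist v (ρ.cfg i) (ρ.cfg (i + 1)) ≤ k

/-- An execution is `f`-constrained if every reconfiguration step changes at most
`f n` edges, where `n` is the number of nodes. -/
def Execution.FConstrained [Fintype V] (f : ℕ → ℕ) (ρ : Execution V P r) : Prop :=
  ∀ i < r, ρ.ty i = .reconf → dist (ρ.cfg i) (ρ.cfg (i + 1)) ≤ f (Fintype.card V)

/-- The number of communication steps of an execution. -/
def Execution.nbcomm (ρ : Execution V P r) : ℕ :=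
  ((Finset.range r).filter (fun i => ρ.ty i = StepType.comm)).card

/-- The total number of edge reconfigurations along an execution. -/
noncomputable def Execution.nbreconfig (ρ : Execution V P r) : ℕ :=
  ∑ i ∈ (Finset.range r).filter (fun i => ρ.ty i = StepType.reconf),
    dist (ρ.cfg i) (ρ.cfg (i + 1))

/-- An execution is `k`-balanced if it starts and ends with a communication step
and `nbreconfig ρ ≤ k * (nbcomm ρ - 1)`. -/
def Execution.Balanced (k : ℕ) (ρ : Execution V P r) : Prop :=
  1 ≤ r ∧ ρ.ty 0 = StepType.comm ∧ ρ.ty (r - 1) = StepType.comm ∧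
    ρ.nbreconfig ≤ k * (ρ.nbcomm - 1)

/-- Juxtaposition `G ⊕ H` of two configurations: disjoint union. -/
def Config.juxt {V W Q : Type} (G : Config V Q) (H : Config W Q) : Config (V ⊕ W) Q where
  graph := SimpleGraph.fromEdgeSet
    (Sym2.map Sum.inl '' G.graph.edgeSet ∪ Sym2.map Sum.inr '' H.graph.edgeSet)
  label := Sum.elim G.label H.label

/-- `G ^ N`: juxtaposition of `N` disjoint copies of `G`. -/
def Config.pow {V Q : Type} (G : Config V Q) (N : ℕ) : Config (V × Fin N) Q where
  graph := SimpleGraph.fromEdgeSet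
    (⋃ i : Fin N, Sym2.map (fun v => (v, i)) '' G.graph.edgeSet)
  label := fun p => G.label p.1

/-- Renaming the nodes of a configuration along a bijection. -/
def Config.rename {V W Q : Type} (e : V ≃ W) (G : Config V Q) : Config W Q where
  graph := SimpleGraph.comap e.symm G.graph
  label := G.label ∘ e.symm


variable {Q M V : Type} {P : BroadcastProtocol Q M} {r : ℕ}

/-- `κ(ρ)`: the total number of repeated atomic reconfigurations of `ρ`, i.e. the sum,
over the reconfiguration steps of `ρ`, of `max(d(G_i, G_{i+1}) - 1, 0)`. -/
noncomputable def Execution.kappa (ρ : Execution V P r) : ℕ :=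
  ∑ i ∈ (Finset.range r).filter (fun i => ρ.ty i = StepType.reconf),
    (dist (ρ.cfg i) (ρ.cfg (i + 1)) - 1)

/-! ### Words without two consecutive reconfigurations -/

/-- A word over step types in which no two reconfigurations are consecutive. -/
def NoRepeat (l : List StepType) : Prop :=
  l.IsChain fun x y => x = .comm ∨ y = .comm

/-- The number of reconfigurations minus the number of communications of a word. -/
def excess (l : List StepType) : ℤ :=
  (l.count .reconf : ℤ) - l.count .comm

@[simp] theorem excess_nil : excess [] = 0 := rfl

@[simp] theorem excess_append (l t : List StepType) : excess (l ++ t) = excess l + excess t := by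
  simp only [excess, List.count_append]; push_cast; ring

@[simp] theorem excess_cons_comm (l : List StepType) : excess (.comm :: l) = excess l - 1 := by
  simp [excess]; ring

@[simp] theorem excess_cons_reconf (l : List StepType) :
    excess (.reconf :: l) = excess l + 1 := by
  simp [excess]; ring

theorem noRepeat_nil : NoRepeat [] := List.isChain_nil

theorem noRepeat_singleton (x : StepType) : NoRepeat [x] := List.isChain_singleton x

theorem noRepeat_cons_comm {l : List StepType} : NoRepeat (.comm :: l) ↔ NoRepeat l := by
  simp [NoRepeat, List.isChain_cons]

theorem noRepeat_reconf_comm {l : List StepType} :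
    NoRepeat (.reconf :: .comm :: l) ↔ NoRepeat l := by
  simp [NoRepeat, List.isChain_cons]

theorem not_noRepeat_reconf_reconf {l : List StepType} :
    ¬ NoRepeat (.reconf :: .reconf :: l) := by
  simp [NoRepeat]

theorem NoRepeat.append_comm {l t : List StepType} (hl : NoRepeat l) (ht : NoRepeat t) :
    NoRepeat (l ++ .comm :: t) := by
  refine List.IsChain.append hl (noRepeat_cons_comm.2 ht) ?_
  simp

theorem NoRepeat.excess_le_one : ∀ {l : List StepType}, NoRepeat l → excess l ≤ 1
  | [], _ => by simp
  | .comm :: l, h => by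
    have := (noRepeat_cons_comm.1 h).excess_le_one
    simp; omega
  | [.reconf], _ => by simp
  | .reconf :: .comm :: l, h => by
    have := (noRepeat_reconf_comm.1 h).excess_le_one
    simpa using this
  | .reconf :: .reconf :: l, h => absurd h not_noRepeat_reconf_reconf

/-- A word with at least as many communications as reconfigurations has a slot where any
other word can be inserted without creating consecutive reconfigurations. -/
theorem NoRepeat.exists_slot : ∀ {l : List StepType}, NoRepeat l → excess l ≤ 0 →
    ∃ l₁ l₂, l = l₁ ++ l₂ ∧ ∀ t, NoRepeat t → NoRepeat (l₁ ++ (t ++ l₂))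
  | [], _, _ => ⟨[], [], rfl, fun t ht => by simpa using ht⟩
  | .comm :: l, h, _ =>
    ⟨[], .comm :: l, rfl, fun _ ht => ht.append_comm (noRepeat_cons_comm.1 h)⟩
  | [.reconf], _, he => by simp at he
  | .reconf :: .comm :: l, h, he => by
    obtain ⟨l₁, l₂, rfl, H⟩ := (noRepeat_reconf_comm.1 h).exists_slot (by simpa using he)
    exact ⟨.reconf :: .comm :: l₁, l₂, rfl, fun t ht => noRepeat_reconf_comm.2 (H t ht)⟩
  | .reconf :: .reconf :: l, h, _ => absurd h not_noRepeat_reconf_reconf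

/-! ### Interleavings -/

/-- The subword of an interleaving performed by the copy `i`. -/
def proj {ι : Type} [DecidableEq ι] (i : ι) (S : List (ι × StepType)) : List StepType :=
  (S.filter fun p => p.1 = i).map Prod.snd

section Interleaving

variable {ι : Type} [DecidableEq ι]

@[simp] theorem proj_nil (i : ι) : proj i [] = [] := rfl

@[simp] theorem proj_append (i : ι) (S T : List (ι × StepType)) :
    proj i (S ++ T) = proj i S ++ proj i T := by
  simp [proj]

@[simp] theorem proj_cons (i j : ι) (x : StepType) (S : List (ι × StepType)) :
    proj i ((j, x) :: S) = if j = i then x :: proj i S else proj i S := by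
  by_cases h : j = i <;> simp [proj, h]

theorem proj_map_mk (i j : ι) (l : List StepType) :
    proj i (l.map (Prod.mk j)) = if j = i then l else [] := by
  induction l with
  | nil => simp
  | cons x l ih => by_cases h : j = i <;> simp_all

/-- Words without consecutive reconfigurations can be interleaved without consecutive
reconfigurations as soon as there are globally enough communications. -/
theorem exists_interleaving (g : ι → List StepType) (s : Finset ι)
    (hg : ∀ i ∈ s, NoRepeat (g i)) (hs : ∑ i ∈ s, excess (g i) ≤ 1) :
    ∃ S : List (ι × StepType), NoRepeat (S.map Prod.snd) ∧
      (∀ i, proj i S = if i ∈ s then g i else []) ∧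
      excess (S.map Prod.snd) = ∑ i ∈ s, excess (g i) := by
  induction s using Finset.strongInduction with
  | H s ih =>
    rcases s.eq_empty_or_nonempty with rfl | hne
    · exact ⟨[], noRepeat_nil, by simp, by simp⟩
    obtain ⟨i, hi, hmax⟩ := Finset.exists_max_image s (fun i => excess (g i)) hne
    have hsum := Finset.add_sum_erase s (fun i => excess (g i)) hi
    have hrest : ∑ j ∈ s.erase i, excess (g j) ≤ 0 := by
      by_cases h1 : 1 ≤ excess (g i)
      · omega
      · refine Finset.sum_nonpos fun j hj => ?_
        have := hmax j (Finset.mem_of_mem_erase hj)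
        omega
    obtain ⟨S, hS, hproj, hex⟩ := ih (s.erase i) (Finset.erase_ssubset hi)
      (fun j hj => hg j (Finset.mem_of_mem_erase hj)) (by omega)
    obtain ⟨l₁, l₂, hl, H⟩ := hS.exists_slot (by omega)
    obtain ⟨S₁, S₂, rfl, rfl, rfl⟩ := List.map_eq_append_iff.1 hl
    have hi₀ : proj i S₁ = [] ∧ proj i S₂ = [] := by simpa using hproj i
    refine ⟨S₁ ++ ((g i).map (Prod.mk i) ++ S₂), ?_, fun j => ?_, ?_⟩
    · simpa [Function.comp_def] using H (g i) (hg i hi)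
    · rw [proj_append, proj_append, proj_map_mk]
      by_cases h : i = j
      · subst h; simp [hi₀, hi]
      · have := hproj j
        simp only [proj_append, Finset.mem_erase, Ne, eq_comm (a := j), h, not_false_eq_true,
          true_and] at this
        simp [h, this]
    · rw [← hsum, ← hex]
      simp [Function.comp_def]; ring

end Interleaving

/-- The copies of a word `comm · μ 0 ⋯ μ κ · comm` can be interleaved, without consecutive
reconfigurations, up to the point where the first `b` communications among all the initial
ones followed by all the final ones have been performed, and the copy `i` has performed the
pieces `μ 0, …, μ (ℓ i - 1)`. -/
def Reach (N : ℕ) (μ : ℕ → List StepType) (b : ℕ) (ℓ : Fin N → ℕ) : Prop :=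
  (∀ i : Fin N, b ≤ i → ℓ i = 0) ∧
  ∃ S : List (Fin N × StepType), NoRepeat (S.map Prod.snd) ∧
    ∀ i : Fin N, proj i S = (if (i : ℕ) < b then [.comm] else []) ++
      ((List.range (ℓ i)).flatMap μ ++ if N + i < b then [.comm] else [])

section Reach

variable {N : ℕ} {μ : ℕ → List StepType} {b : ℕ} {ℓ : Fin N → ℕ}

theorem reach_zero : Reach N μ 0 fun _ => 0 :=
  ⟨fun _ _ => rfl, [], noRepeat_nil, fun i => by simp⟩

theorem Reach.step (h : Reach N μ b ℓ) (hμ : ∀ r, NoRepeat (μ r)) (hb : b < 2 * N)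
    (s : Finset (Fin N)) (hs : ∑ i ∈ s, excess (μ (ℓ i)) ≤ 1)
    (hsb : ∀ i ∈ s, (i : ℕ) ≤ b ∧ b < N + i) :
    Reach N μ (b + 1) fun i => ℓ i + if i ∈ s then 1 else 0 := by
  obtain ⟨h0, S, hS, hproj⟩ := h
  obtain ⟨T, hT, hprojT, -⟩ := exists_interleaving (fun i => μ (ℓ i)) s (fun i _ => hμ _) hs
  refine ⟨fun i hi => ?_, ?_⟩
  · have : i ∉ s := fun his => by have := hsb i his; omega
    simp [this, h0 i (by omega)]
  obtain ⟨p, hp⟩ : ∃ p : Fin N, (p : ℕ) = b ∨ N + p = b := by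
    by_cases hbN : b < N
    · exact ⟨⟨b, hbN⟩, Or.inl rfl⟩
    · exact ⟨⟨b - N, by omega⟩, Or.inr (by simp; omega)⟩
  refine ⟨S ++ (p, .comm) :: T, ?_, fun i => ?_⟩
  · simpa using hS.append_comm hT
  rw [proj_append, proj_cons, hproj, hprojT]
  have hpN := p.2
  have hiN := i.2
  by_cases hpi : p = i
  · subst hpi
    rcases hp with hp | hp
    · have hN : N ≠ 0 := by omega
      by_cases hps : p ∈ s <;> simp [h0 p hp.ge, hp, hN, hps]
    · have hps : p ∉ s := fun his => by have := hsb p his; omega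
      have h1 : (p : ℕ) < b := by omega
      have h2 : (p : ℕ) < b + 1 := by omega
      simp [hps, h1, h2, hp]
  · have hne : (p : ℕ) ≠ i := fun hh => hpi (Fin.ext hh)
    have h1 : (i : ℕ) < b + 1 ↔ (i : ℕ) < b := by omega
    have h2 : N + (i : ℕ) < b + 1 ↔ N + (i : ℕ) < b := by omega
    by_cases his : i ∈ s
    · have h3 : ¬ N + (i : ℕ) < b := by have := hsb i his; omega
      simp [his, hpi, h1, h2, h3, List.range_succ]
    · simp [his, hpi, h1, h2]

theorem Reach.skip (h : Reach N μ b ℓ) (hμ : ∀ r, NoRepeat (μ r)) {b' : ℕ} (hb : b ≤ b')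
    (hb' : b' ≤ 2 * N) : Reach N μ b' ℓ := by
  induction b', hb using Nat.le_induction with
  | base => exact h
  | succ c hc ih => simpa using (ih (by omega)).step hμ (by omega) ∅ (by simp) (by simp)

/-- Copies can be advanced one at a time, each piece using one communication of another copy. -/
theorem Reach.raise (hμ : ∀ r, NoRepeat (μ r)) (D : ℕ) (ℓ' : Fin N → ℕ) :
    ∀ {b : ℕ} {ℓ : Fin N → ℕ}, Reach N μ b ℓ → ℓ ≤ ℓ' → ∑ i, (ℓ' i - ℓ i) = D →
      b + D ≤ 2 * N → (∀ i, ℓ i < ℓ' i → (i : ℕ) ≤ b ∧ b + D ≤ N + i) →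
      Reach N μ (b + D) ℓ' := by
  induction D with
  | zero =>
    intro b ℓ h hle hsum _ _
    have : ℓ = ℓ' := le_antisymm hle fun i => by
      exact Nat.le_of_sub_eq_zero ((Finset.sum_eq_zero_iff.1 hsum) i (Finset.mem_univ i))
    exact this ▸ h
  | succ D ih =>
    intro b ℓ h hle hsum hb hi
    obtain ⟨i, -, hne⟩ := Finset.exists_ne_zero_of_sum_ne_zero (hsum.trans_ne D.succ_ne_zero)
    have hlt : ℓ i < ℓ' i := by omega
    have hib := hi i hlt
    have h' := h.step hμ (by omega) {i} (by simpa using (hμ _).excess_le_one)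
      (by simpa using ⟨hib.1, by omega⟩)
    rw [show b + (D + 1) = b + 1 + D by ring]
    refine ih h' (fun j => ?_) ?_ (by omega) (fun j hj => ?_)
    · by_cases hj : j = i
      · subst hj; simpa using hlt
      · simpa [hj] using hle j
    · have h1 := Finset.add_sum_erase Finset.univ (fun j => ℓ' j - ℓ j) (Finset.mem_univ i)
      have h2 := Finset.add_sum_erase Finset.univ
        (fun j => ℓ' j - (ℓ j + if j ∈ ({i} : Finset (Fin N)) then 1 else 0)) (Finset.mem_univ i)
      rw [Finset.sum_congr rfl (g := fun j => ℓ' j - ℓ j) fun j hj => by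
        simp [Finset.ne_of_mem_erase hj]] at h2
      simp only [Finset.mem_singleton, if_true] at h1 h2 ⊢
      omega
    · have := hi j (by omega)
      omega

/-- Advance simultaneously, from one piece to the next, a window of `κ + 1` copies each of
which is at a different piece. -/
theorem Reach.window (hμ : ∀ r, NoRepeat (μ r)) {κ : ℕ}
    (hsum : ∑ r ∈ Finset.range (κ + 1), excess (μ r) ≤ 1) {k : ℕ} (hk : k + κ < N)
    (hkb : k + κ ≤ b) (hbk : b < N + k)
    (h : Reach N μ b fun i => min (κ + 1) (k + κ - i)) :
    Reach N μ (b + 1) fun i => min (κ + 1) (k + 1 + κ - i) := by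
  have h' := h.step hμ (by omega) {i | k ≤ (i : ℕ) ∧ (i : ℕ) ≤ k + κ} ?_ ?_
  · convert h' using 2 with i
    simp only [Finset.mem_filter, Finset.mem_univ, true_and]
    split_ifs <;> omega
  · refine le_of_eq_of_le ?_ hsum
    refine Finset.sum_bij' (fun i _ => k + κ - i) (fun r hr => ⟨k + κ - r, by omega⟩) ?_ ?_ ?_ ?_ ?_
    · intro i hi; simp at hi ⊢; omega
    · intro r hr; simp at hr ⊢; omega
    · intro i hi; ext; simp at hi ⊢; omega
    · intro r hr; simp at hr ⊢; omega
    · intro i hi; simp at hi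
      rw [min_eq_right (by omega)]
  · intro i hi; simp at hi; omega

theorem reach_end {κ : ℕ} (hκ : 1 ≤ κ) (hN : κ ^ 2 + κ ≤ N) (hμ : ∀ r, NoRepeat (μ r))
    (hsum : ∑ r ∈ Finset.range (κ + 1), excess (μ r) ≤ 1) :
    Reach N μ (2 * N) fun _ => κ + 1 := by
  have hκ2 : κ ≤ κ ^ 2 := by nlinarith
  obtain ⟨T, hT⟩ : ∃ T, T = ∑ i : Fin N, (κ - (i : ℕ)) := ⟨_, rfl⟩
  have hT2 : 2 * T = κ ^ 2 + κ := by
    have h1 : T = ∑ i ∈ Finset.range (κ + 1), (κ - i) := by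
      rw [hT, Fin.sum_univ_eq_sum_range (fun i => κ - i)]
      refine (Finset.sum_subset (Finset.range_mono (by omega)) fun i _ hi => ?_).symm
      simp at hi; omega
    have h2 := Finset.sum_range_reflect (fun i => i) (κ + 1)
    simp only [Nat.add_sub_cancel] at h2
    have h3 := Finset.sum_range_id_mul_two (κ + 1)
    rw [h1, h2, mul_comm, h3]
    simp; ring
  have hT' : T = ∑ i : Fin N, (κ + 1 - min (κ + 1) (N - i)) := by
    rw [hT, ← Equiv.sum_comp Fin.revPerm]
    refine Finset.sum_congr rfl fun i _ => ?_
    simp only [Fin.revPerm_apply, Fin.val_rev]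
    omega
  let z : Fin N := ⟨0, by omega⟩
  have hfirst : Reach N μ κ fun i => if i = z then κ else 0 := by
    have := Reach.raise hμ κ (fun i => if i = z then κ else 0) (reach_zero (N := N) (μ := μ))
      (fun _ => Nat.zero_le _) (by simp) (by omega) (fun i hi => by
        have : i = z := by by_contra hne; simp [hne] at hi
        subst this; simp [z]; omega)
    simpa using this
  have hstart : Reach N μ T fun i => min (κ + 1) (0 + κ - i) := by
    have hD : ∑ i : Fin N, (min (κ + 1) (0 + κ - i) - if i = z then κ else 0) = T - κ := by
      have h1 := Finset.add_sum_erase Finset.univ (fun i : Fin N => κ - (i : ℕ))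
        (Finset.mem_univ z)
      rw [← Finset.add_sum_erase _ _ (Finset.mem_univ z)]
      rw [Finset.sum_congr rfl (g := fun i : Fin N => κ - (i : ℕ)) fun j hj => by
        simp [Finset.ne_of_mem_erase hj]; omega]
      simp [z] at h1 ⊢
      omega
    have := hfirst.raise hμ (T - κ) (fun i => min (κ + 1) (0 + κ - i)) (fun i => by
      by_cases hi : i = z
      · subst hi; simp [z]
      · simp [hi]) hD (by omega) (fun i hi => by omega)
    rwa [show κ + (T - κ) = T by omega] at this
  have hmiddle : ∀ k, k + κ ≤ N → Reach N μ (T + k) fun i => min (κ + 1) (k + κ - i) := by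
    intro k
    induction k with
    | zero => exact fun _ => hstart
    | succ k ih =>
      intro hk
      exact Reach.window (b := T + k) hμ hsum (by omega) (by omega) (by omega) (ih (by omega))
  have hend := (hmiddle (N - κ) (by omega)).raise hμ T (fun _ => κ + 1)
    (fun i => by simp) (by rw [hT', Nat.sub_add_cancel (by omega)]) (by omega)
    (fun i hi => by omega)
  exact hend.skip hμ (by omega) le_rfl

/-- If a word starting and ending with a communication has at most `κ` pairs of consecutive
reconfigurations and more communications than reconfigurations, then `κ ^ 2 + κ` copies of it
or more can be interleaved without consecutive reconfigurations. -/
theorem exists_interleaving_copies {κ : ℕ} (hκ : 1 ≤ κ) (hN : κ ^ 2 + κ ≤ N)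
    (hμ : ∀ r, NoRepeat (μ r)) (hsum : ∑ r ∈ Finset.range (κ + 1), excess (μ r) ≤ 1) :
    ∃ S : List (Fin N × StepType), NoRepeat (S.map Prod.snd) ∧
      ∀ i, proj i S = .comm :: ((List.range (κ + 1)).flatMap μ ++ [.comm]) := by
  obtain ⟨-, S, hS, h⟩ := reach_end hκ hN hμ hsum
  refine ⟨S, hS, fun i => ?_⟩
  have := i.2
  simpa [show (i : ℕ) < 2 * N by omega, show N + (i : ℕ) < 2 * N by omega] using h i

end Reach

/-! ### Decomposing a word at its repeated reconfigurations -/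

/-- The word `m` is the concatenation of `κ + 1` words without consecutive reconfigurations. -/
def Splits (κ : ℕ) (m : List StepType) : Prop :=
  ∃ μ : ℕ → List StepType, (∀ r, NoRepeat (μ r)) ∧ (List.range (κ + 1)).flatMap μ = m

theorem splits_nil : Splits 0 [] := ⟨fun _ => [], fun _ => noRepeat_nil, by simp⟩

theorem splits_singleton (x : StepType) : Splits 0 [x] :=
  ⟨fun _ => [x], fun _ => noRepeat_singleton x, by simp⟩

theorem NoRepeat.of_splits_zero {m : List StepType} (h : Splits 0 m) : NoRepeat m := by
  obtain ⟨μ, hμ, rfl⟩ := h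
  simpa using hμ 0

theorem Splits.prepend {κ : ℕ} {l m : List StepType} (h : Splits κ m)
    (hl : ∀ t, NoRepeat t → NoRepeat (l ++ t)) : Splits κ (l ++ m) := by
  obtain ⟨μ, hμ, rfl⟩ := h
  refine ⟨fun r => if r = 0 then l ++ μ r else μ r, fun r => ?_, ?_⟩
  · dsimp only
    split_ifs
    · exact hl _ (hμ r)
    · exact hμ r
  · simp [List.range_succ_eq_map, List.flatMap_map]

theorem Splits.cons_reconf {κ : ℕ} {m : List StepType} (h : Splits κ m) :
    Splits (κ + 1) (.reconf :: m) := by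
  obtain ⟨μ, hμ, rfl⟩ := h
  refine ⟨fun r => if r = 0 then [.reconf] else μ (r - 1), fun r => ?_, ?_⟩
  · dsimp only
    split_ifs
    · exact noRepeat_singleton _
    · exact hμ _
  · rw [List.range_succ_eq_map]
    simp [List.flatMap_map]

theorem splits_replicate : ∀ d : ℕ, Splits (d - 1) (List.replicate d .reconf)
  | 0 => splits_nil
  | 1 => splits_singleton _
  | d + 2 => (splits_replicate (d + 1)).cons_reconf

theorem Splits.replicate_append {κ : ℕ} {m : List StepType} (h : Splits κ m) :
    ∀ d : ℕ, Splits (d - 1 + κ) (List.replicate d .reconf ++ .comm :: m)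
  | 0 => by
    simpa using h.prepend (l := [.comm]) fun t ht => noRepeat_cons_comm.2 ht
  | 1 => by
    simpa using h.prepend (l := [.reconf, .comm]) fun t ht => noRepeat_reconf_comm.2 ht
  | d + 2 => by
    have := (h.replicate_append (d + 1)).cons_reconf
    rwa [show d + 1 - 1 + κ + 1 = d + 2 - 1 + κ by omega] at this

/-! ### Atomic decomposition of executions -/

/-- An atomic reconfiguration: at most one edge changes. -/
def AtomicReconf {V Q : Type} (G H : Config V Q) : Prop :=
  ReconfStep G H ∧ ∃ e, symmDiff G.graph.edgeSet H.graph.edgeSet ⊆ {e}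

/-- A word of atomic reconfigurations and communications leads from `G` to `K`. Any
reconfiguration of cost zero is allowed before a communication. -/
inductive Path {V Q M : Type} (P : BroadcastProtocol Q M) :
    Config V Q → List StepType → Config V Q → Prop
  | nil (G : Config V Q) : Path P G [] G
  | reconf {G H K : Config V Q} {l : List StepType} (h : AtomicReconf G H) (p : Path P H l K) :
      Path P G (.reconf :: l) K
  | comm {G G' H K : Config V Q} {l : List StepType} (h : ReconfStep G G') (h0 : dist G G' = 0)
      (hc : CommStep P G' H) (p : Path P H l K) : Path P G (.comm :: l) K

/-- A reconfiguration of at most one edge followed by a communication. -/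
def Block {V Q M : Type} (P : BroadcastProtocol Q M) (G K : Config V Q) : Prop :=
  ∃ H, ReconfStep G H ∧ dist G H ≤ 1 ∧ CommStep P H K

section Dynamics

variable {V Q M : Type} {P : BroadcastProtocol Q M}

theorem Config.ext_iff' {G H : Config V Q} : G = H ↔ G.graph = H.graph ∧ G.label = H.label := by
  cases G; cases H; simp

@[simp] theorem dist_self (G : Config V Q) : dist G G = 0 := by
  simp [dist]

theorem Path.eq_of_nil {G K : Config V Q} (p : Path P G [] K) : G = K := by
  cases p; rfl

theorem Path.of_cons_reconf {G K : Config V Q} {l : List StepType}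
    (p : Path P G (.reconf :: l) K) : ∃ H, AtomicReconf G H ∧ Path P H l K := by
  cases p with
  | reconf h p => exact ⟨_, h, p⟩

theorem Path.of_cons_comm {G K : Config V Q} {l : List StepType}
    (p : Path P G (.comm :: l) K) :
    ∃ G' H, ReconfStep G G' ∧ dist G G' = 0 ∧ CommStep P G' H ∧ Path P H l K := by
  cases p with
  | comm h h0 hc p => exact ⟨_, _, h, h0, hc, p⟩

theorem Path.append {G H K : Config V Q} {l t : List StepType} (p : Path P G l H)
    (q : Path P H t K) : Path P G (l ++ t) K := by
  induction p with
  | nil => exact q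
  | reconf h _ ih => exact .reconf h (ih q)
  | comm h h0 hc _ ih => exact .comm h h0 hc (ih q)

theorem path_of_finite (K : Config V Q) (d : ℕ) : ∀ G : Config V Q, ReconfStep G K →
    (symmDiff G.graph.edgeSet K.graph.edgeSet).Finite → dist G K = d →
    Path P G (List.replicate d .reconf) K := by
  induction d with
  | zero =>
    intro G h hf hd
    have h0 := (Set.ncard_eq_zero hf).1 hd
    have : G = K := Config.ext_iff'.2
      ⟨SimpleGraph.edgeSet_injective (symmDiff_eq_bot.1 h0), h.symm⟩
    exact this ▸ Path.nil G
  | succ d ih =>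
    intro G h hf hd
    have hne : (symmDiff G.graph.edgeSet K.graph.edgeSet).Nonempty := by
      rw [← Set.ncard_pos hf]
      exact lt_of_lt_of_eq d.succ_pos hd.symm
    obtain ⟨e, he⟩ := hne
    have hdiag : ¬ e.IsDiag := by
      rcases he with he | he
      · exact G.graph.not_isDiag_of_mem_edgeSet he.1
      · exact K.graph.not_isDiag_of_mem_edgeSet he.1
    let H : Config V Q := ⟨.fromEdgeSet (symmDiff G.graph.edgeSet {e}), G.label⟩
    have hH : H.graph.edgeSet = symmDiff G.graph.edgeSet {e} := by
      simp only [H, SimpleGraph.edgeSet_fromEdgeSet]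
      refine sdiff_eq_left.2 (Set.disjoint_left.2 fun x hx hxd => ?_)
      rcases hx with hx | hx
      · exact G.graph.not_isDiag_of_mem_edgeSet hx.1 hxd
      · exact hdiag (Set.mem_singleton_iff.1 hx.1 ▸ hxd)
    have hHK : symmDiff H.graph.edgeSet K.graph.edgeSet =
        symmDiff G.graph.edgeSet K.graph.edgeSet \ {e} := by
      rw [hH, symmDiff_right_comm]
      ext x
      simp only [Set.mem_symmDiff, Set.mem_sdiff, Set.mem_singleton_iff] at he ⊢
      by_cases hx : x = e
      · subst hx; tauto
      · tauto
    refine .reconf (H := H) ⟨rfl, e, ?_⟩ (ih H h ?_ ?_)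
    · rw [hH, symmDiff_symmDiff_cancel_left]
    · rw [hHK]; exact hf.sdiff
    · rw [dist, hHK, Set.ncard_sdiff_singleton_of_mem he]
      exact Nat.sub_eq_of_eq_add hd

theorem path_of_reconf_comm {G H K : Config V Q} (h : ReconfStep G H) (hc : CommStep P H K) :
    Path P G (List.replicate (dist G H) .reconf ++ [.comm]) K := by
  by_cases h0 : dist G H = 0
  · rw [h0]
    exact .comm h h0 hc (.nil K)
  · exact (path_of_finite H _ G h (Set.finite_of_ncard_ne_zero h0) rfl).append
      (.comm rfl (dist_self H) hc (.nil K))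

/-- The configurations reached at odd times of an alternating sequence are related by words
with as many repeated reconfigurations as the sequence. -/
theorem exists_path (cfg : ℕ → Config V Q) (n k : ℕ) : ∀ s, s + k < n →
    (∀ i < n, ReconfStep (cfg (2 * i + 1)) (cfg (2 * i + 2))) →
    (∀ i < n, CommStep P (cfg (2 * i + 2)) (cfg (2 * i + 3))) →
    ∃ m, Splits (∑ i ∈ Finset.range (k + 1),
        (dist (cfg (2 * (s + i) + 1)) (cfg (2 * (s + i) + 2)) - 1)) m ∧
      excess m = ∑ i ∈ Finset.range (k + 1),
        (dist (cfg (2 * (s + i) + 1)) (cfg (2 * (s + i) + 2)) : ℤ) - k ∧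
      Path P (cfg (2 * s + 1)) (m ++ [.comm]) (cfg (2 * (s + k) + 3)) := by
  induction k with
  | zero =>
    intro s hs hr hc
    refine ⟨_, ?_, ?_, path_of_reconf_comm (hr s hs) (hc s hs)⟩
    · simpa using splits_replicate _
    · simp [excess, List.count_replicate]
  | succ k ih =>
    intro s hs hr hc
    obtain ⟨m, hm, he, hp⟩ := ih (s + 1) (by omega) hr hc
    have hshift : ∀ i, s + 1 + i = s + (i + 1) := fun i => by ring
    simp only [hshift] at hm he hp
    refine ⟨List.replicate (dist (cfg (2 * s + 1)) (cfg (2 * s + 2))) .reconf ++ .comm :: m,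
      ?_, ?_, ?_⟩
    · rw [Finset.sum_range_succ', add_comm]
      exact hm.replicate_append _
    · rw [Finset.sum_range_succ', excess_append, excess_cons_comm, he]
      simp [excess, List.count_replicate]
      ring
    · simpa using (path_of_reconf_comm (hr s (by omega)) (hc s (by omega))).append hp

/-! ### Juxtaposing the copies -/

/-- The juxtaposition of a family of configurations. -/
def Config.copies {ι : Type} (F : ι → Config V Q) : Config (V × ι) Q where
  graph :=
    { Adj := fun x y => x.2 = y.2 ∧ (F x.2).graph.Adj x.1 y.1
      symm := ⟨fun _ _ h => ⟨h.1.symm, h.1 ▸ h.2.symm⟩⟩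
      loopless := ⟨fun _ h => h.2.ne rfl⟩ }
  label := fun p => (F p.2).label p.1

theorem Config.copies_const (G : Config V Q) (N : ℕ) :
    Config.copies (fun _ : Fin N => G) = G.pow N := by
  refine Config.ext_iff'.2 ⟨?_, rfl⟩
  ext ⟨u, i⟩ ⟨v, j⟩
  simp only [Config.copies, Config.pow, SimpleGraph.fromEdgeSet_adj, Set.mem_iUnion, Set.mem_image]
  constructor
  · rintro ⟨h, hadj⟩
    obtain rfl : i = j := h
    exact ⟨⟨i, s(u, v), hadj, rfl⟩, fun h => hadj.ne (congrArg Prod.fst h)⟩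
  · rintro ⟨⟨k, e, he, heq⟩, -⟩
    induction e using Sym2.ind with
    | _ x y =>
      simp only [Sym2.map_mk, Sym2.eq_iff, Prod.mk.injEq] at heq
      rcases heq with ⟨⟨rfl, rfl⟩, rfl, rfl⟩ | ⟨⟨rfl, rfl⟩, rfl, rfl⟩
      · exact ⟨rfl, he⟩
      · exact ⟨rfl, SimpleGraph.Adj.symm he⟩

section Copies

variable {ι : Type} [DecidableEq ι]

theorem Config.symmDiff_copies_update (F : ι → Config V Q) (i : ι) (H : Config V Q) :
    symmDiff (Config.copies F).graph.edgeSet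
      (Config.copies (Function.update F i H)).graph.edgeSet =
    Sym2.map (fun v => (v, i)) '' symmDiff (F i).graph.edgeSet H.graph.edgeSet := by
  ext e
  induction e using Sym2.ind with
  | _ x y =>
    obtain ⟨u, j⟩ := x
    obtain ⟨v, k⟩ := y
    constructor
    · intro h
      simp only [Set.mem_symmDiff, SimpleGraph.mem_edgeSet, Config.copies] at h
      have hjk : j = k := by tauto
      subst hjk
      by_cases hj : j = i
      · subst hj
        exact ⟨s(u, v), by simpa [Set.mem_symmDiff] using h, rfl⟩
      · simp [hj] at h
    · rintro ⟨e, he, heq⟩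
      rw [← heq]
      induction e using Sym2.ind with
      | _ x y => simpa [Set.mem_symmDiff, Config.copies] using he

theorem dist_copies_update (F : ι → Config V Q) (i : ι) (H : Config V Q) :
    dist (Config.copies F) (Config.copies (Function.update F i H)) = dist (F i) H := by
  rw [dist, Config.symmDiff_copies_update, dist]
  exact Set.ncard_image_of_injective _ (Sym2.map.injective fun _ _ h => congrArg Prod.fst h)

theorem ReconfStep.copies_update {F : ι → Config V Q} {i : ι} {H : Config V Q}
    (h : ReconfStep (F i) H) :
    ReconfStep (Config.copies F) (Config.copies (Function.update F i H)) := by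
  funext ⟨v, j⟩
  by_cases hj : j = i
  · subst hj; simpa [Config.copies] using congrFun h v
  · simp [Config.copies, hj]

theorem CommStep.copies_update {F : ι → Config V Q} {i : ι} {H : Config V Q}
    (h : CommStep P (F i) H) :
    CommStep P (Config.copies F) (Config.copies (Function.update F i H)) := by
  obtain ⟨hg, v, m, hv, hadj, hrest⟩ := h
  refine ⟨?_, (v, i), m, ?_, ?_, ?_⟩
  · ext ⟨u, j⟩ ⟨w, k⟩
    by_cases hj : j = i
    · subst hj; simp [Config.copies, hg]
    · simp [Config.copies, hj]
  · simpa [Config.copies] using hv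
  · rintro ⟨u, j⟩ ⟨hij, hu⟩
    obtain rfl : i = j := hij
    simpa [Config.copies] using hadj u hu
  · rintro ⟨u, j⟩ hne hu
    by_cases hj : j = i
    · subst hj
      simpa [Config.copies] using
        hrest u (fun h => hne (by rw [h])) (fun h => hu ⟨rfl, h⟩)
    · simp [Config.copies, hj]

theorem AtomicReconf.copies_update {F : ι → Config V Q} {i : ι} {H : Config V Q}
    (h : AtomicReconf (F i) H) :
    AtomicReconf (Config.copies F) (Config.copies (Function.update F i H)) := by
  obtain ⟨hl, e, he⟩ := h
  refine ⟨hl.copies_update, Sym2.map (fun v => (v, i)) e, ?_⟩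
  rw [Config.symmDiff_copies_update, ← Set.image_singleton]
  exact Set.image_mono he

theorem AtomicReconf.dist_le_one {G H K : Config V Q} (h : AtomicReconf G H)
    (h0 : dist H K = 0) : dist G K ≤ 1 := by
  obtain ⟨-, e, he⟩ := h
  rcases (symmDiff H.graph.edgeSet K.graph.edgeSet).finite_or_infinite with hf | hf
  · have := symmDiff_eq_bot.1 ((Set.ncard_eq_zero hf).1 h0)
    rw [dist, ← this, ← Set.ncard_singleton e]
    exact Set.ncard_le_ncard he
  · have hinf : (symmDiff G.graph.edgeSet K.graph.edgeSet).Infinite := fun hfin => by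
      refine hf ((((Set.finite_singleton e).subset he).union hfin).subset ?_)
      rw [symmDiff_comm G.graph.edgeSet H.graph.edgeSet]
      exact symmDiff_triangle _ _ _
    rw [dist, hinf.ncard]
    exact Nat.zero_le 1

/-- An interleaving of paths without consecutive reconfigurations, ending with a
communication, is a path of blocks of the juxtaposition. -/
theorem reflTransGen_block {K : ι → Config V Q} : ∀ (S : List (ι × StepType))
    (F : ι → Config V Q), NoRepeat (S.map Prod.snd ++ [.reconf]) →
    (∀ i, Path P (F i) (proj i S) (K i)) →
    Relation.ReflTransGen (Block P) (Config.copies F) (Config.copies K)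
  | [], F, _, h => by
    have : F = K := funext fun i => (h i).eq_of_nil
    exact this ▸ .refl
  | (i, .comm) :: S, F, hS, h => by
    have hi := h i
    simp only [proj_cons, if_true] at hi
    obtain ⟨G', H, hr, h0, hc, hp⟩ := hi.of_cons_comm
    have hc' : CommStep P (Function.update F i G' i) H := by simpa using hc
    refine .head ⟨_, hr.copies_update, ?_, hc'.copies_update⟩
      (reflTransGen_block S _ (noRepeat_cons_comm.1 hS) fun j => ?_)
    · rw [dist_copies_update, h0]; exact Nat.zero_le 1
    · by_cases hj : j = i
      · subst hj; simpa using hp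
      · simpa [hj, Ne.symm hj] using h j
  | [(i, .reconf)], F, hS, h => absurd hS not_noRepeat_reconf_reconf
  | (j, .reconf) :: (i, .comm) :: S, F, hS, h => by
    have hj := h j
    rw [proj_cons, if_pos rfl] at hj
    obtain ⟨J, ha, hq⟩ := hj.of_cons_reconf
    have h' : ∀ k, Path P (Function.update F j J k) (proj k ((i, .comm) :: S)) (K k) := by
      intro k
      by_cases hk : k = j
      · subst hk; simpa using hq
      · have := h k
        rw [proj_cons, if_neg (Ne.symm hk)] at this
        simpa [hk] using this
    have hi := h' i
    simp only [proj_cons, if_true] at hi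
    generalize hF' : Function.update F j J = F' at h' hi
    obtain ⟨G', H, hr, h0, hc, hp⟩ := hi.of_cons_comm
    have hc' : CommStep P (Function.update F' i G' i) H := by simpa using hc
    have ha' := ha.copies_update
    rw [hF'] at ha'
    refine .head ⟨_, hr.copies_update.trans ha'.1, ha'.dist_le_one ?_, hc'.copies_update⟩
      (reflTransGen_block S _ (noRepeat_reconf_comm.1 hS) fun k => ?_)
    · rw [dist_copies_update, h0]
    · by_cases hk : k = i
      · subst hk; simpa using hp
      · simpa [hk, Ne.symm hk] using h' k
  | (i, .reconf) :: (j, .reconf) :: S, F, hS, h => absurd hS not_noRepeat_reconf_reconf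

end Copies

theorem exists_execution_of_reflTransGen {G K : Config V Q}
    (h : Relation.ReflTransGen (Block P) G K) :
    ∃ (r : ℕ) (ρ : Execution V P r), ρ.KConstrained 1 ∧ ρ.cfg 0 = G ∧ ρ.cfg r = K := by
  obtain ⟨k, f, hf0, hfk, hf⟩ : ∃ (k : ℕ) (f : ℕ → Config V Q), f 0 = G ∧ f k = K ∧
      ∀ i < k, Block P (f i) (f (i + 1)) := by
    induction h with
    | refl => exact ⟨0, fun _ => G, rfl, rfl, by simp⟩
    | @tail H K _ hb ih =>
      obtain ⟨k, f, hf0, hfk, hf⟩ := ih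
      refine ⟨k + 1, fun i => if i ≤ k then f i else K, by simpa using hf0, by simp, ?_⟩
      intro i hi
      rcases Nat.lt_succ_iff_lt_or_eq.1 hi with hi | rfl
      · simpa [hi.le, Nat.succ_le_of_lt hi] using hf i hi
      · simpa [hfk] using hb
  have hex : ∀ i, ∃ H, i < k → ReconfStep (f i) H ∧ dist (f i) H ≤ 1 ∧
      CommStep P H (f (i + 1)) := fun i => by
    by_cases hi : i < k
    · obtain ⟨H, hH⟩ := hf i hi
      exact ⟨H, fun _ => hH⟩
    · exact ⟨G, fun h => absurd h hi⟩
  choose g hg using hex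
  let cfg : ℕ → Config V Q := fun i => if i % 2 = 0 then f (i / 2) else g (i / 2)
  have heven : ∀ i, cfg (2 * i) = f i := fun i => by simp [cfg]
  have hodd : ∀ i, cfg (2 * i + 1) = g i := fun i => by
    simp [cfg, Nat.add_mod, Nat.mul_add_div]
  have hr : ∀ i < 2 * k, i % 2 = 0 → ReconfStep (cfg i) (cfg (i + 1)) ∧
      dist (cfg i) (cfg (i + 1)) ≤ 1 := fun i hi hi2 => by
    obtain ⟨j, rfl⟩ : ∃ j, i = 2 * j := ⟨i / 2, by omega⟩
    rw [heven, hodd]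
    exact ⟨(hg j (by omega)).1, (hg j (by omega)).2.1⟩
  refine ⟨2 * k, ⟨cfg, fun i => if i % 2 = 0 then .reconf else .comm, ?_, ?_, ?_⟩, ?_, ?_, ?_⟩
  · intro i hi hty
    have hi2 : i % 2 ≠ 0 := fun h => by simp [h] at hty
    obtain ⟨j, rfl⟩ : ∃ j, i = 2 * j + 1 := ⟨i / 2, by omega⟩
    rw [hodd, show 2 * j + 1 + 1 = 2 * (j + 1) by ring, heven]
    exact (hg j (by omega)).2.2
  · intro i hi hty
    exact (hr i hi (by by_contra h; simp [h] at hty)).1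
  · intro i _
    rcases Nat.mod_two_eq_zero_or_one i with h | h <;> simp [h, Nat.add_mod]
  · intro i hi hty
    exact (hr i hi (by by_contra h; simp [h] at hty)).2
  · exact (heven 0).trans hf0
  · exact (heven k).trans hfk

end Dynamics

theorem Execution.ty_eq {V Q M : Type} {P : BroadcastProtocol Q M} {n : ℕ}
    (ρ : Execution V P n) (h0 : ρ.ty 0 = .comm) :
    ∀ i < n, ρ.ty i = if i % 2 = 0 then .comm else .reconf := by
  intro i
  induction i with
  | zero => exact fun _ => by simpa using h0
  | succ i ih =>
    intro hi
    have h1 := ρ.alternate i hi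
    have h2 := ih (by omega)
    rcases Nat.mod_two_eq_zero_or_one i with h | h <;>
      cases h3 : ρ.ty (i + 1) <;> simp_all [Nat.add_mod]

theorem sum_filter_reconf {ty : ℕ → StepType} (f : ℕ → ℕ) (k : ℕ)
    (h : ∀ i < 2 * k + 1, ty i = if i % 2 = 0 then .comm else .reconf) :
    ∑ i ∈ (Finset.range (2 * k + 1)).filter (fun i => ty i = .reconf), f i =
      ∑ i ∈ Finset.range k, f (2 * i + 1) := by
  rw [Finset.sum_filter]
  induction k with
  | zero => simp [h 0]
  | succ k ih =>
    rw [show 2 * (k + 1) + 1 = 2 * k + 1 + 1 + 1 by ring, Finset.sum_range_succ,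
      Finset.sum_range_succ, ih fun i hi => h i (by omega), Finset.sum_range_succ,
      h (2 * k + 1) (by omega), h (2 * k + 1 + 1) (by omega)]
    simp [Nat.add_mod]

theorem card_filter_comm {ty : ℕ → StepType} (k : ℕ)
    (h : ∀ i < 2 * k + 1, ty i = if i % 2 = 0 then .comm else .reconf) :
    ((Finset.range (2 * k + 1)).filter (fun i => ty i = .comm)).card = k + 1 := by
  have h1 := sum_filter_reconf (fun _ => 1) k h
  have h2 := Finset.card_filter_add_card_filter_not (s := Finset.range (2 * k + 1))
    (fun i => ty i = .comm)
  have h3 : ∀ i, ¬ ty i = .comm ↔ ty i = .reconf := fun i => by cases ty i <;> simp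
  simp only [h3] at h2
  simp at h1 h2
  omega

/-- An interleaving of `N` copies of the word of a path yields a `1`-constrained execution. -/
theorem exists_execution_of_interleaving {V Q M : Type} {P : BroadcastProtocol Q M} {N : ℕ}
    {G K : Config V Q} {w : List StepType} (hp : Path P G (w ++ [.comm]) K)
    {S : List (Fin N × StepType)} (hS : NoRepeat (S.map Prod.snd))
    (hproj : ∀ i, proj i S = w ++ [.comm]) :
    ∃ (r : ℕ) (ρ : Execution (V × Fin N) P r),
      ρ.KConstrained 1 ∧ ρ.cfg 0 = G.pow N ∧ ρ.cfg r = K.pow N := by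
  rw [← Config.copies_const, ← Config.copies_const]
  refine exists_execution_of_reflTransGen (reflTransGen_block S _ ?_ fun i => hproj i ▸ hp)
  rcases S.eq_nil_or_concat with rfl | ⟨S', ⟨i, x⟩, rfl⟩
  · exact noRepeat_singleton _
  · have := hproj i
    simp only [List.concat_eq_append, proj_append, proj_cons, if_true, proj_nil] at this
    obtain ⟨-, hx⟩ := List.append_inj' this rfl
    obtain rfl : x = .comm := by simpa using hx
    refine List.IsChain.append hS (noRepeat_singleton _) ?_
    simp

/-- Proposition refining the `k`-constrained/`k`-balanced theorem.
For every `1`-balanced execution `ρ = (G_i)_{0 ≤ i ≤ n}` with `κ = κ(ρ)` its total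
number of repeated atomic reconfigurations, and every `N ≥ κ² + κ`, there exists a
`1`-constrained execution from `G_0^N` to `G_n^N`. -/
theorem oneBalanced_to_oneConstrained_power {n : ℕ} (ρ : Execution V P n)
    (hbal : ρ.Balanced 1) (κ : ℕ) (hκ : κ = ρ.kappa) :
    ∀ N : ℕ, κ ^ 2 + κ ≤ N →
      ∃ (r' : ℕ) (ρ' : Execution (V × Fin N) P r'),
        ρ'.KConstrained 1 ∧
        ρ'.cfg 0 = (ρ.cfg 0).pow N ∧
        ρ'.cfg r' = (ρ.cfg n).pow N := by
  intro N hN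
  obtain ⟨hn, hfirst, hlast, hbal⟩ := hbal
  have hty := ρ.ty_eq hfirst
  obtain ⟨k, rfl⟩ : ∃ k, n = 2 * k + 1 := by
    refine ⟨n / 2, ?_⟩
    by_contra hne
    rw [hty (n - 1) (by omega), if_neg (by omega)] at hlast
    cases hlast
  rw [Execution.nbreconfig, sum_filter_reconf _ k hty, Execution.nbcomm,
    card_filter_comm k hty] at hbal
  rw [Execution.kappa, sum_filter_reconf _ k hty] at hκ
  have hr : ∀ i < k, ReconfStep (ρ.cfg (2 * i + 1)) (ρ.cfg (2 * i + 2)) := fun i hi =>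
    ρ.step_reconf _ (by omega) (by rw [hty _ (by omega), if_neg (by omega)])
  have hc : ∀ i < k, CommStep P (ρ.cfg (2 * i + 2)) (ρ.cfg (2 * i + 3)) := fun i hi =>
    ρ.step_comm _ (by omega) (by rw [hty _ (by omega), if_pos (by omega)])
  have hc0 : CommStep P (ρ.cfg 0) (ρ.cfg 1) := ρ.step_comm 0 (by omega) hfirst
  rcases k with - | k
  · obtain ⟨S, hS, hproj, -⟩ := exists_interleaving (fun _ : Fin N => [StepType.comm]) Finset.univ
      (fun _ _ => noRepeat_singleton _) (by simp)
    exact exists_execution_of_interleaving (w := [])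
      (.comm rfl (dist_self _) hc0 (.nil _)) hS (by simpa using hproj)
  obtain ⟨m, hm, he, hp⟩ := exists_path ρ.cfg (k + 1) k 0 (by omega) hr hc
  simp only [zero_add] at hm he hp
  rw [← hκ] at hm
  have hem : excess m ≤ 1 := by
    rw [he]
    have : ((∑ i ∈ Finset.range (k + 1),
      dist (ρ.cfg (2 * i + 1)) (ρ.cfg (2 * i + 2)) : ℕ) : ℤ) ≤ k + 1 := by
      exact_mod_cast hbal.trans (by simp)
    push_cast at this
    omega
  have hpath : Path P (ρ.cfg 0) ((.comm :: m) ++ [.comm]) (ρ.cfg (2 * (k + 1) + 1)) :=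
    .comm rfl (dist_self _) hc0 hp
  rcases Nat.eq_zero_or_pos κ with h0 | hpos
  · rw [h0] at hm
    obtain ⟨S, hS, hproj, -⟩ := exists_interleaving
      (fun _ : Fin N => (StepType.comm :: m) ++ [.comm]) Finset.univ
      (fun _ _ => (noRepeat_cons_comm.2 (NoRepeat.of_splits_zero hm)).append_comm noRepeat_nil)
      ((Finset.sum_nonpos fun _ _ => by simp; omega).trans zero_le_one)
    exact exists_execution_of_interleaving hpath hS (by simpa using hproj)
  · obtain ⟨μ, hμ, rfl⟩ := hm
    have hsum : ∀ j, excess ((List.range j).flatMap μ) = ∑ r ∈ Finset.range j, excess (μ r) := by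
      intro j
      induction j with
      | zero => rfl
      | succ j ih => simp [List.range_succ, Finset.sum_range_succ, ih]
    obtain ⟨S, hS, hproj⟩ := exists_interleaving_copies hpos hN hμ (hsum _ ▸ hem)
    exact exists_execution_of_interleaving hpath hS hproj

end RBN
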